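/- arXiv:1401.7896 — 4 statements merged into one kernel-verified Lean document; each statement's English description precedes it below -/
import Mathlib

section
/- Let n ≥ 1, let J₁,…,Jₙ be arbitrary index sets, and let F be a Banach space which contains no copy of c₀. Then every continuous n-linear map T : c₀(J₁) × ⋯ × c₀(Jₙ) → F is approximable, i.e., T lies in the operator-norm closure of the finite type n-linear maps from c₀(J₁) × ⋯ × c₀(Jₙ) to F. -/
open Filter Topology

noncomputable section

namespace GV

/-- A continuous multilinear map is of *finite type* if it is a finite sum of maps of the form
`(x₁, …, xₙ) ↦ φ₁(x₁)⋯φₙ(xₙ) • f` with the `φᵢ` continuous linear functionals and `f ∈ F`. -/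
def IsFiniteType {𝕜 : Type*} [RCLike 𝕜] {n : ℕ} {E : Fin n → Type*}
    [∀ i, NormedAddCommGroup (E i)] [∀ i, NormedSpace 𝕜 (E i)]
    {F : Type*} [NormedAddCommGroup F] [NormedSpace 𝕜 F]
    (T : ContinuousMultilinearMap 𝕜 E F) : Prop :=
  ∃ (r : ℕ) (φ : Fin r → ∀ i, E i →L[𝕜] 𝕜) (f : Fin r → F),
    ∀ x : ∀ i, E i, T x = ∑ p : Fin r, (∏ i, φ p i (x i)) • f p

/-- A continuous multilinear map is *approximable* if it lies in the operator-norm closure of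
the set of finite type continuous multilinear maps. -/
def Approximable {𝕜 : Type*} [RCLike 𝕜] {n : ℕ} {E : Fin n → Type*}
    [∀ i, NormedAddCommGroup (E i)] [∀ i, NormedSpace 𝕜 (E i)]
    {F : Type*} [NormedAddCommGroup F] [NormedSpace 𝕜 F]
    (T : ContinuousMultilinearMap 𝕜 E F) : Prop :=
  T ∈ closure {S : ContinuousMultilinearMap 𝕜 E F | IsFiniteType S}

/-- A Banach space `F` contains a copy of `c₀` if there is a continuous linear map
`ι : c₀ → F` which is an isomorphism onto its range, i.e. there are constants `0 < c ≤ C`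
with `c‖x‖ ≤ ‖ι x‖ ≤ C‖x‖` for all `x ∈ c₀`. -/
def ContainsCopyOfC0 (𝕜 F : Type*) [RCLike 𝕜] [NormedAddCommGroup F] [NormedSpace 𝕜 F] : Prop :=
  ∃ (ι : ZeroAtInftyContinuousMap ℕ 𝕜 →L[𝕜] F) (c C : ℝ), 0 < c ∧ c ≤ C ∧
    ∀ x : ZeroAtInftyContinuousMap ℕ 𝕜, c * ‖x‖ ≤ ‖ι x‖ ∧ ‖ι x‖ ≤ C * ‖x‖

open scoped ZeroAtInfty

section Rosenthal

/-- A quantitative form of Rosenthal's disjointness lemma for nonnegative matrices with uniformly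
bounded rows. -/
theorem exists_injective_offDiagonal_sum_le {ε : ℝ} (hε : 0 ≤ ε) (m : ℕ) (a : ℕ → ℕ → ℝ)
    (ha : ∀ k j, 0 ≤ a k j) (hrow : ∀ k (s : Finset ℕ), ∑ j ∈ s, a k j ≤ m * ε) :
    ∃ f : ℕ → ℕ, Function.Injective f ∧
      ∀ k (s : Finset ℕ), k ∉ s → ∑ j ∈ s, a (f k) (f j) ≤ ε := by
  induction m generalizing a with
  | zero =>
    exact ⟨id, Function.injective_id, fun k s _ => (hrow k s).trans (by simpa using hε)⟩
  | succ m ih =>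
    by_cases h : ∃ p, ∀ q (s : Finset ℕ), q ∉ s →
        ∑ j ∈ s, a (Nat.pair p q) (Nat.pair p j) ≤ ε
    · obtain ⟨p, hp⟩ := h
      exact ⟨Nat.pair p, fun x y hxy => (Nat.pair_eq_pair.1 hxy).2, hp⟩
    · push Not at h
      choose q s hqs hlt using h
      have hg : Function.Injective fun p => Nat.pair p (q p) :=
        fun x y hxy => (Nat.pair_eq_pair.1 hxy).1
      have hinj : ∀ p, Function.Injective (Nat.pair p) :=
        fun p x y hxy => (Nat.pair_eq_pair.1 hxy).2
      obtain ⟨f, hf, hsum⟩ := ih (fun k j => a (Nat.pair k (q k)) (Nat.pair j (q j)))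
        (fun _ _ => ha _ _) (fun k t => by
          have hdisj : Disjoint (t.image fun p => Nat.pair p (q p)) ((s k).image (Nat.pair k)) := by
            rw [Finset.disjoint_left]
            intro x hx hx'
            obtain ⟨i, -, rfl⟩ := Finset.mem_image.1 hx
            obtain ⟨j, hj, hij⟩ := Finset.mem_image.1 hx'
            obtain ⟨rfl, rfl⟩ := Nat.pair_eq_pair.1 hij
            exact hqs _ hj
          have h1 := hrow (Nat.pair k (q k))
            ((t.image fun p => Nat.pair p (q p)) ∪ (s k).image (Nat.pair k))
          rw [Finset.sum_union hdisj, Finset.sum_image hg.injOn,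
            Finset.sum_image (hinj k).injOn] at h1
          have h2 := hlt k
          push_cast at h1
          linarith)
      exact ⟨_, hg.comp hf, hsum⟩

end Rosenthal

section C0

variable {𝕜 : Type*} [RCLike 𝕜] {J : Type*} [TopologicalSpace J]

theorem norm_apply_le (x : C₀(J, 𝕜)) (j : J) : ‖x j‖ ≤ ‖x‖ :=
  x.toBCF.norm_coe_le_norm j

theorem norm_le_of_forall {x : C₀(J, 𝕜)} {M : ℝ} (hM : 0 ≤ M) (h : ∀ j, ‖x j‖ ≤ M) : ‖x‖ ≤ M :=
  (BoundedContinuousFunction.norm_le (f := x.toBCF) hM).2 h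

theorem zeroAtInfty_sum_apply {ι : Type*} (s : Finset ι) (u : ι → C₀(J, 𝕜)) (j : J) :
    (∑ i ∈ s, u i) j = ∑ i ∈ s, u i j := by
  classical
  induction s using Finset.induction_on with
  | empty => simp
  | insert a s ha ih => simp [Finset.sum_insert ha, ih]

/-- Evaluation at a point, as a continuous linear functional. -/
def evalCLM (𝕜 : Type*) [RCLike 𝕜] (j : J) : C₀(J, 𝕜) →L[𝕜] 𝕜 :=
  LinearMap.mkContinuous
    { toFun := fun x => x j
      map_add' := fun _ _ => rfl
      map_smul' := fun _ _ => rfl } 1 fun x => by simpa using norm_apply_le x j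

@[simp] theorem evalCLM_apply (j : J) (x : C₀(J, 𝕜)) : evalCLM 𝕜 j x = x j := rfl

/-- Linear combinations of disjointly supported elements of the unit ball are controlled by the
largest coefficient. -/
theorem norm_sum_smul_le_of_disjoint {ι : Type*} (s : Finset ι) (u : ι → C₀(J, 𝕜)) (a : ι → 𝕜)
    {M : ℝ} (hM : 0 ≤ M) (hu : ∀ i, ‖u i‖ ≤ 1)
    (hdisj : ∀ i k, i ≠ k → ∀ j, u i j = 0 ∨ u k j = 0) (ha : ∀ i ∈ s, ‖a i‖ ≤ M) :
    ‖∑ i ∈ s, a i • u i‖ ≤ M := by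
  refine norm_le_of_forall hM fun j => ?_
  rw [zeroAtInfty_sum_apply]
  by_cases h : ∃ i ∈ s, u i j ≠ 0
  · obtain ⟨i, hi, hij⟩ := h
    rw [Finset.sum_eq_single_of_mem i hi fun k _ hki => by
      simp [(hdisj k i hki j).resolve_right hij]]
    calc ‖(a i • u i) j‖ = ‖a i‖ * ‖u i j‖ := by simp
      _ ≤ M * 1 := by
        gcongr
        · exact ha i hi
        · exact (norm_apply_le _ _).trans (hu i)
      _ = M := mul_one M
  · push Not at h
    rw [Finset.sum_eq_zero fun i hi => by simp [h i hi]]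
    simpa using hM

variable [DiscreteTopology J]

theorem finite_setOf_le_norm (x : C₀(J, 𝕜)) {ε : ℝ} (hε : 0 < ε) : {j | ε ≤ ‖x j‖}.Finite := by
  have h := x.zero_at_infty'
  rw [cocompact_eq_cofinite, Metric.tendsto_nhds] at h
  simpa [Filter.eventually_cofinite] using h ε hε

open Classical in
/-- The unit vectors of `c₀(J)`. -/
def unitVec (𝕜 : Type*) [RCLike 𝕜] (a : J) : C₀(J, 𝕜) where
  toFun := Pi.single (M := fun _ => 𝕜) a 1
  continuous_toFun := continuous_of_discreteTopology
  zero_at_infty' := by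
    rw [cocompact_eq_cofinite]
    refine tendsto_const_nhds.congr' ?_
    filter_upwards [(Set.finite_singleton a).compl_mem_cofinite] with j hj
    exact (Pi.single_eq_of_ne (M := fun _ => 𝕜) (by simpa using hj) 1).symm

@[simp] theorem unitVec_self (a : J) : unitVec 𝕜 a a = 1 := by
  classical exact Pi.single_eq_same (M := fun _ => 𝕜) a 1

theorem unitVec_of_ne {a j : J} (h : j ≠ a) : unitVec 𝕜 a j = 0 := by
  classical exact Pi.single_eq_of_ne (M := fun _ => 𝕜) h 1

theorem norm_unitVec (a : J) : ‖unitVec 𝕜 a‖ = 1 := by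
  refine le_antisymm (norm_le_of_forall zero_le_one fun j => ?_) ?_
  · by_cases h : j = a
    · simp [h]
    · simp [unitVec_of_ne h]
  · simpa using norm_apply_le (unitVec 𝕜 a) a

theorem unitVec_disjoint {a b : J} (h : a ≠ b) (j : J) : unitVec 𝕜 a j = 0 ∨ unitVec 𝕜 b j = 0 := by
  by_cases hj : j = a
  · exact Or.inr (unitVec_of_ne (hj ▸ h))
  · exact Or.inl (unitVec_of_ne hj)

/-- Truncation of an element of `c₀(J)` to a finite set of coordinates. -/
def trunc (A : Finset J) (x : C₀(J, 𝕜)) : C₀(J, 𝕜) := ∑ a ∈ A, x a • unitVec 𝕜 a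

theorem trunc_apply_of_mem {A : Finset J} (x : C₀(J, 𝕜)) {j : J} (hj : j ∈ A) :
    trunc A x j = x j := by
  rw [trunc, zeroAtInfty_sum_apply, Finset.sum_eq_single_of_mem j hj]
  · simp
  · intro b _ hb
    simp [unitVec_of_ne hb.symm]

theorem trunc_apply_of_notMem {A : Finset J} (x : C₀(J, 𝕜)) {j : J} (hj : j ∉ A) :
    trunc A x j = 0 := by
  rw [trunc, zeroAtInfty_sum_apply]
  refine Finset.sum_eq_zero fun b hb => ?_
  have : j ≠ b := fun h => hj (h ▸ hb)
  simp [unitVec_of_ne this]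

theorem norm_trunc_le (A : Finset J) (x : C₀(J, 𝕜)) : ‖trunc A x‖ ≤ ‖x‖ := by
  refine norm_le_of_forall (norm_nonneg x) fun j => ?_
  by_cases hj : j ∈ A
  · rw [trunc_apply_of_mem x hj]
    exact norm_apply_le x j
  · simp [trunc_apply_of_notMem x hj]

theorem norm_sub_trunc_le (A : Finset J) (x : C₀(J, 𝕜)) : ‖x - trunc A x‖ ≤ ‖x‖ := by
  refine norm_le_of_forall (norm_nonneg x) fun j => ?_
  by_cases hj : j ∈ A
  · simp [trunc_apply_of_mem x hj]
  · simpa [trunc_apply_of_notMem x hj] using norm_apply_le x j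

theorem tendsto_trunc (x : C₀(J, 𝕜)) : Tendsto (fun A => trunc A x) atTop (𝓝 x) := by
  rw [Metric.tendsto_nhds]
  intro ε hε
  filter_upwards [eventually_ge_atTop (finite_setOf_le_norm x (half_pos hε)).toFinset] with A hA
  rw [dist_comm, dist_eq_norm]
  refine (norm_le_of_forall (half_pos hε).le fun j => ?_).trans_lt (half_lt_self hε)
  by_cases hj : j ∈ A
  · simpa [trunc_apply_of_mem x hj] using (half_pos hε).le
  · have : ¬ ε / 2 ≤ ‖x j‖ := fun h => hj (hA (by simpa using h))
    simpa [trunc_apply_of_notMem x hj] using (not_le.1 this).le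

theorem finite_support_trunc (A : Finset J) (x : C₀(J, 𝕜)) :
    (Function.support (trunc A x)).Finite :=
  A.finite_toSet.subset fun j hj => by
    by_contra h
    exact hj (trunc_apply_of_notMem x h)

end C0

theorem exists_trunc_lt_norm {𝕜 J F : Type*} [RCLike 𝕜] [TopologicalSpace J] [DiscreteTopology J]
    [NormedAddCommGroup F] [NormedSpace 𝕜 F] (T : C₀(J, 𝕜) →L[𝕜] F) {x : C₀(J, 𝕜)} {r : ℝ}
    (h : r < ‖T x‖) : ∃ A : Finset J, r < ‖T (trunc A x)‖ :=
  (((T.continuous.norm.tendsto x).comp (tendsto_trunc x)).eventually (lt_mem_nhds h)).exists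

section BessagaPelczynski

variable {𝕜 : Type*} [RCLike 𝕜] {F : Type*} [NormedAddCommGroup F] [NormedSpace 𝕜 F]

theorem ContainsCopyOfC0.of_isometry {G : Type*} [NormedAddCommGroup G] [NormedSpace 𝕜 G]
    (L : G →L[𝕜] F) (hL : ∀ g, ‖L g‖ = ‖g‖) (h : ContainsCopyOfC0 𝕜 G) :
    ContainsCopyOfC0 𝕜 F := by
  obtain ⟨ι, c, C, hc, hcC, hι⟩ := h
  exact ⟨L.comp ι, c, C, hc, hcC, fun x => by simpa [hL] using hι x⟩

theorem containsCopyOfC0_of_lower_bound (S : C₀(ℕ, 𝕜) →L[𝕜] F) {c : ℝ} (hc : 0 < c)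
    (h : ∀ x, c * ‖x‖ ≤ ‖S x‖) : ContainsCopyOfC0 𝕜 F :=
  ⟨S, c, max c ‖S‖, hc, le_max_left _ _, fun x => ⟨h x, (S.le_opNorm x).trans (by
    gcongr
    exact le_max_right _ _)⟩⟩

/-- The diagonal of a bilinear map is an average over signs of its values. -/
theorem norm_add_sum_diag_le {ι E G : Type*} [NormedAddCommGroup E] [NormedSpace 𝕜 E]
    [NormedAddCommGroup G] [NormedSpace 𝕜 G] (B : E →L[𝕜] G →L[𝕜] F) (u : ι → E) (y : ι → G)
    {K : ℝ} (s : Finset ι) (v : E) (w : G)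
    (h : ∀ θ : ι → 𝕜, (∀ i, ‖θ i‖ ≤ 1) →
      ‖B (v + ∑ i ∈ s, θ i • u i) (w + ∑ i ∈ s, θ i • y i)‖ ≤ K) :
    ‖B v w + ∑ i ∈ s, B (u i) (y i)‖ ≤ K := by
  classical
  induction s using Finset.induction_on generalizing v w with
  | empty => simpa using h 0 (by simp)
  | insert a s ha ih =>
    have step : ∀ t : 𝕜, ‖t‖ ≤ 1 →
        ‖B (v + t • u a) (w + t • y a) + ∑ i ∈ s, B (u i) (y i)‖ ≤ K := by
      intro t ht
      refine ih _ _ fun θ hθ => ?_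
      have h1 := h (Function.update θ a t) fun i => by
        by_cases hi : i = a
        · simpa [hi] using ht
        · simpa [Function.update_of_ne hi] using hθ i
      have h3 : ∀ i ∈ s, Function.update θ a t i = θ i := fun i hi =>
        Function.update_of_ne (ne_of_mem_of_not_mem hi ha) _ _
      rw [Finset.sum_insert ha, Finset.sum_insert ha, Function.update_self,
        Finset.sum_congr rfl fun i hi => by rw [h3 i hi],
        Finset.sum_congr (g := fun i => θ i • y i) rfl fun i hi => by rw [h3 i hi],
        ← add_assoc, ← add_assoc] at h1
      exact h1
    have h1 := step 1 (by simp)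
    have h2 := step (-1) (by simp)
    rw [Finset.sum_insert ha]
    have h3 : (2 : 𝕜) • (B v w + (B (u a) (y a) + ∑ i ∈ s, B (u i) (y i))) =
        (B (v + (1 : 𝕜) • u a) (w + (1 : 𝕜) • y a) + ∑ i ∈ s, B (u i) (y i)) +
          (B (v + (-1 : 𝕜) • u a) (w + (-1 : 𝕜) • y a) + ∑ i ∈ s, B (u i) (y i)) := by
      simp only [map_add, map_smul, add_apply, smul_apply]
      module
    have h4 := (norm_add_le_of_le h1 h2)
    rw [← h3, norm_smul, RCLike.norm_two] at h4
    linarith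

variable [CompleteSpace F]

/-- The Bessaga–Pełczyński theorem for seminormalized weakly unconditionally Cauchy series. -/
theorem containsCopyOfC0_of_wuc (z : ℕ → F) {C ε : ℝ} (hε : 0 < ε) (hz : ∀ k, ε ≤ ‖z k‖)
    (hC : ∀ (s : Finset ℕ) (a : ℕ → 𝕜) (M : ℝ), 0 ≤ M → (∀ k ∈ s, ‖a k‖ ≤ M) →
      ‖∑ k ∈ s, a k • z k‖ ≤ C * M) : ContainsCopyOfC0 𝕜 F := by
  choose φ hφ hφz using fun k => exists_dual_vector'' 𝕜 (z k)
  have hφle : ∀ k y, ‖φ k y‖ ≤ ‖y‖ := fun k y =>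
    ((φ k).le_of_opNorm_le (hφ k) y).trans (by simp)
  have hrow : ∀ k (s : Finset ℕ), ∑ j ∈ s, ‖φ k (z j)‖ ≤ C := by
    intro k s
    have hphase : ∀ w : 𝕜, ∃ t : 𝕜, ‖t‖ ≤ 1 ∧ t * w = (‖w‖ : 𝕜) := fun w => by
      obtain ⟨g, hg, hgw⟩ := exists_dual_vector'' 𝕜 w
      refine ⟨g 1, (g.le_of_opNorm_le hg 1).trans (by simp), ?_⟩
      rw [← hgw, mul_comm, ← smul_eq_mul, ← map_smul, smul_eq_mul, mul_one]
    choose t ht htw using hphase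
    have h1 := (hφle k _).trans (hC s (fun j => t (φ k (z j))) 1 zero_le_one fun j _ => ht _)
    have h2 : φ k (∑ j ∈ s, t (φ k (z j)) • z j) = ((∑ j ∈ s, ‖φ k (z j)‖ : ℝ) : 𝕜) := by
      simp [map_sum, htw]
    rw [h2, mul_one] at h1
    rw [RCLike.norm_ofReal] at h1
    exact (le_abs_self _).trans h1
  obtain ⟨m, hm⟩ := exists_nat_ge (C / (ε / 2))
  obtain ⟨f, hf, hoff⟩ := exists_injective_offDiagonal_sum_le (half_pos hε).le m
    (fun k j => ‖φ k (z j)‖) (fun _ _ => norm_nonneg _)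
    (fun k s => (hrow k s).trans ((div_le_iff₀ (half_pos hε)).1 hm))
  have hC' : ∀ (s : Finset ℕ) (a : ℕ → 𝕜) (M : ℝ), 0 ≤ M → (∀ k ∈ s, ‖a k‖ ≤ M) →
      ‖∑ k ∈ s, a k • z (f k)‖ ≤ C * M := by
    intro s a M hM ha
    have h := hC (s.image f) (fun j => a (Function.invFun f j)) M hM (by
      intro j hj
      obtain ⟨k, hk, rfl⟩ := Finset.mem_image.1 hj
      simpa [Function.leftInverse_invFun hf k] using ha k hk)
    rw [Finset.sum_image hf.injOn] at h
    simpa [Function.leftInverse_invFun hf _] using h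
  have hC0 : 0 ≤ C := by simpa using hrow 0 ∅
  have hsum : ∀ x : C₀(ℕ, 𝕜), Summable fun k => x k • z (f k) := by
    intro x
    rw [summable_iff_vanishing_norm]
    intro δ hδ
    have hδ' : 0 < δ / (C + 1) := by positivity
    refine ⟨(finite_setOf_le_norm x hδ').toFinset, fun t ht => ?_⟩
    refine (hC' t x _ hδ'.le fun k hk => ?_).trans_lt ?_
    · have := Finset.disjoint_left.1 ht hk
      simp only [Set.Finite.mem_toFinset, Set.mem_ofPred_eq, not_le] at this
      exact this.le
    · rw [mul_div_assoc', div_lt_iff₀ (by positivity)]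
      nlinarith
  let S : C₀(ℕ, 𝕜) →L[𝕜] F := LinearMap.mkContinuous
    { toFun := fun x => ∑' k, x k • z (f k)
      map_add' := fun x y => by
        simp only [ZeroAtInftyContinuousMap.add_apply, add_smul]
        exact (hsum x).tsum_add (hsum y)
      map_smul' := fun c x => by
        simp only [ZeroAtInftyContinuousMap.smul_apply, smul_assoc, RingHom.id_apply]
        exact (hsum x).tsum_const_smul c } C fun x =>
      le_of_tendsto (hsum x).hasSum.norm (Eventually.of_forall fun s =>
        hC' s x _ (norm_nonneg x) fun k _ => norm_apply_le x k)
  have hS : ∀ x, HasSum (fun k => x k • z (f k)) (S x) := fun x => (hsum x).hasSum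
  refine containsCopyOfC0_of_lower_bound S (half_pos hε) fun x => ?_
  have key : ∀ k, ε * ‖x k‖ ≤ ‖S x‖ + ε / 2 * ‖x‖ := by
    intro k
    rw [← sub_le_iff_le_add]
    refine ge_of_tendsto (hS x).norm ?_
    filter_upwards [eventually_ge_atTop {k}] with s hs
    have hk : k ∈ s := hs (Finset.mem_singleton_self k)
    refine le_trans ?_ (hφle (f k) _)
    rw [← Finset.add_sum_erase _ _ hk, map_add, map_smul, hφz, map_sum]
    have h1 : ‖∑ j ∈ s.erase k, φ (f k) (x j • z (f j))‖ ≤ ε / 2 * ‖x‖ :=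
      calc ‖∑ j ∈ s.erase k, φ (f k) (x j • z (f j))‖
          ≤ ∑ j ∈ s.erase k, ‖φ (f k) (z (f j))‖ * ‖x‖ := by
            refine norm_sum_le_of_le _ fun j _ => ?_
            rw [map_smul, norm_smul, mul_comm]
            gcongr
            exact norm_apply_le x j
        _ ≤ ε / 2 * ‖x‖ := by
            rw [← Finset.sum_mul]
            gcongr
            exact hoff k _ (Finset.notMem_erase k s)
    have h2 : ε * ‖x k‖ ≤ ‖x k • ((‖z (f k)‖ : ℝ) : 𝕜)‖ := by
      rw [norm_smul, mul_comm]
      gcongr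
      simpa using hz (f k)
    have h3 := norm_sub_le_norm_add (x k • ((‖z (f k)‖ : ℝ) : 𝕜))
      (∑ j ∈ s.erase k, φ (f k) (x j • z (f j)))
    linarith
  have h : ‖x‖ ≤ (‖S x‖ + ε / 2 * ‖x‖) / ε :=
    norm_le_of_forall (by positivity) fun k => (le_div_iff₀ hε).2 (by linarith [key k])
  rw [le_div_iff₀ hε] at h
  linarith

/-- Operators from `c₀(J)` into a space without copies of `c₀` are small off a finite set. -/
theorem exists_finset_norm_apply_le (hF : ¬ ContainsCopyOfC0 𝕜 F) {J : Type*} [TopologicalSpace J]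
    [DiscreteTopology J] (T : C₀(J, 𝕜) →L[𝕜] F) {ε : ℝ} (hε : 0 < ε) :
    ∃ A : Finset J, ∀ x : C₀(J, 𝕜), (∀ j ∈ A, x j = 0) → ‖T x‖ ≤ ε * ‖x‖ := by
  by_contra! h
  have : Std.Symm fun x y : C₀(J, 𝕜) => ∀ j, x j = 0 ∨ y j = 0 := ⟨fun _ _ h j => (h j).symm⟩
  obtain ⟨u, hu, hdisj⟩ := exists_seq_of_forall_finset_exists'
    (fun x : C₀(J, 𝕜) => ‖x‖ ≤ 1 ∧ ε < ‖T x‖ ∧ (Function.support x).Finite)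
    (fun x y => ∀ j, x j = 0 ∨ y j = 0) (by
      intro s hs
      have hfin : (⋃ x ∈ s, Function.support x).Finite :=
        s.finite_toSet.biUnion fun x hx => (hs x hx).2.2
      obtain ⟨x, hx, hlt⟩ := h hfin.toFinset
      have hx0 : 0 < ‖x‖ := norm_pos_iff.2 fun h0 => by simp [h0] at hlt
      have hlt' : ε < ‖T (((‖x‖⁻¹ : ℝ) : 𝕜) • x)‖ := by
        rw [map_smul, norm_smul, RCLike.norm_ofReal, abs_of_pos (inv_pos.2 hx0),
          inv_mul_eq_div, lt_div_iff₀ hx0]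
        exact hlt
      obtain ⟨B, hB⟩ := exists_trunc_lt_norm T hlt'
      refine ⟨_, ⟨(norm_trunc_le _ _).trans ?_, hB, finite_support_trunc _ _⟩, fun y hy j => ?_⟩
      · rw [norm_smul, RCLike.norm_ofReal, abs_of_pos (inv_pos.2 hx0), inv_mul_cancel₀ hx0.ne']
      · refine or_iff_not_imp_left.2 fun hyj => ?_
        have hxj : x j = 0 := hx j (hfin.mem_toFinset.2 (Set.mem_biUnion hy hyj))
        by_cases hj : j ∈ B
        · simp [trunc_apply_of_mem _ hj, hxj]
        · exact trunc_apply_of_notMem _ hj)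
  refine hF (containsCopyOfC0_of_wuc (𝕜 := 𝕜) (fun k => T (u k)) (C := ‖T‖) hε
    (fun k => (hu k).2.1.le) fun s a M hM ha => ?_)
  have h1 : ∑ k ∈ s, a k • T (u k) = T (∑ k ∈ s, a k • u k) := by simp [map_sum]
  rw [h1]
  exact T.le_opNorm_of_le
    (norm_sum_smul_le_of_disjoint s u a hM (fun k => (hu k).1) (fun _ _ hik => hdisj hik) ha)

theorem tendsto_apply_unitVec (hF : ¬ ContainsCopyOfC0 𝕜 F) {J : Type*} [TopologicalSpace J]
    [DiscreteTopology J] (T : C₀(J, 𝕜) →L[𝕜] F) :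
    Tendsto (fun j => T (unitVec 𝕜 j)) cofinite (𝓝 0) := by
  rw [Metric.tendsto_nhds]
  intro ε hε
  obtain ⟨A, hA⟩ := exists_finset_norm_apply_le hF T (half_pos hε)
  filter_upwards [A.finite_toSet.compl_mem_cofinite] with j hj
  have h := hA (unitVec 𝕜 j) fun i hi => unitVec_of_ne fun hij => hj (hij ▸ hi)
  rw [norm_unitVec] at h
  rw [dist_zero_right]
  linarith

/-- If `F` contains no copy of `c₀`, then neither does the space of operators from `c₀(J)`
to `F`. -/
theorem not_containsCopyOfC0_clm (hF : ¬ ContainsCopyOfC0 𝕜 F) (J : Type*) [TopologicalSpace J]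
    [DiscreteTopology J] : ¬ ContainsCopyOfC0 𝕜 (C₀(J, 𝕜) →L[𝕜] F) := by
  rintro ⟨ι, c, C, hc, -, hι⟩
  have : Std.Symm fun p q : ℕ × C₀(J, 𝕜) => p.1 ≠ q.1 ∧ ∀ j, p.2 j = 0 ∨ q.2 j = 0 :=
    ⟨fun _ _ h => ⟨h.1.symm, fun j => (h.2 j).symm⟩⟩
  obtain ⟨p, hp, hdisj⟩ := exists_seq_of_forall_finset_exists'
    (fun p : ℕ × C₀(J, 𝕜) => ‖p.2‖ ≤ 1 ∧ c / 4 < ‖ι (unitVec 𝕜 p.1) p.2‖ ∧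
      (Function.support p.2).Finite)
    (fun p q => p.1 ≠ q.1 ∧ ∀ j, p.2 j = 0 ∨ q.2 j = 0) (by
      intro s hs
      have hfin : (⋃ q ∈ s, Function.support q.2).Finite :=
        s.finite_toSet.biUnion fun q hq => (hs q hq).2.2
      set A := hfin.toFinset
      have hlim : Tendsto (fun k => ∑ a ∈ A, ‖ι (unitVec 𝕜 k) (unitVec 𝕜 a)‖) cofinite (𝓝 0) := by
        simpa using tendsto_finsetSum A fun a _ =>
          (tendsto_apply_unitVec hF (ι.flip (unitVec 𝕜 a))).norm
      obtain ⟨k, hkA, hks⟩ := ((hlim.eventually (gt_mem_nhds (by positivity : 0 < c / 4))).and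
        (s.finite_toSet.image Prod.fst).compl_mem_cofinite).exists
      have hk : c / 2 < ‖ι (unitVec 𝕜 k)‖ := by
        have := (hι (unitVec 𝕜 k)).1
        rw [norm_unitVec] at this
        linarith
      obtain ⟨x, hx, hxlt⟩ := (ι (unitVec 𝕜 k)).exists_lt_apply_of_lt_opNorm hk
      obtain ⟨B, hB⟩ := exists_trunc_lt_norm _ hxlt
      set y := trunc B x
      have hy : ‖y‖ ≤ 1 := (norm_trunc_le B x).trans hx.le
      refine ⟨(k, y - trunc A y), ⟨(norm_sub_trunc_le A y).trans hy, ?_, ?_⟩, fun q hq => ⟨?_, ?_⟩⟩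
      · have h1 : ‖ι (unitVec 𝕜 k) (trunc A y)‖ ≤
            ∑ a ∈ A, ‖ι (unitVec 𝕜 k) (unitVec 𝕜 a)‖ := by
          rw [trunc, map_sum]
          refine norm_sum_le_of_le _ fun a _ => ?_
          rw [map_smul, norm_smul]
          exact mul_le_of_le_one_left (norm_nonneg _) ((norm_apply_le y a).trans hy)
        have h2 := norm_sub_norm_le (ι (unitVec 𝕜 k) y) (ι (unitVec 𝕜 k) (trunc A y))
        rw [← map_sub] at h2
        dsimp only at hkA ⊢
        linarith
      · exact ((finite_support_trunc B x).union (finite_support_trunc A y)).subset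
          (Function.support_sub _ _)
      · exact fun h => hks ⟨q, hq, h⟩
      · intro j
        refine or_iff_not_imp_left.2 fun hqj => ?_
        have hj : j ∈ A := hfin.mem_toFinset.2 (Set.mem_biUnion hq hqj)
        simp [trunc_apply_of_mem y hj])
  refine hF (containsCopyOfC0_of_wuc (𝕜 := 𝕜) (fun k => ι (unitVec 𝕜 (p k).1) (p k).2)
    (C := ‖ι‖) (by positivity : 0 < c / 4) (fun k => (hp k).2.1.le) fun s a M hM ha => ?_)
  have h := norm_add_sum_diag_le ι (fun k => a k • unitVec 𝕜 (p k).1) (fun k => (p k).2)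
    (K := ‖ι‖ * M) s 0 0 fun θ hθ => by
      have h1 : ‖∑ k ∈ s, θ k • a k • unitVec 𝕜 (p k).1‖ ≤ M := by
        simp only [smul_smul]
        refine norm_sum_smul_le_of_disjoint s _ _ hM (fun k => (norm_unitVec _).le)
          (fun i k hik => unitVec_disjoint (hdisj hik).1) fun k hk => ?_
        rw [norm_mul]
        exact (mul_le_of_le_one_left (norm_nonneg _) (hθ k)).trans (ha k hk)
      have h2 : ‖∑ k ∈ s, θ k • (p k).2‖ ≤ 1 :=
        norm_sum_smul_le_of_disjoint s _ _ zero_le_one (fun k => (hp k).1)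
          (fun i k hik => (hdisj hik).2) fun k _ => hθ k
      rw [zero_add, zero_add]
      simpa using (ι _).le_of_opNorm_le_of_le (ι.le_opNorm_of_le h1) h2
  simpa using h

end BessagaPelczynski

section Approximable

variable {𝕜 : Type*} [RCLike 𝕜] {n : ℕ} {F : Type*} [NormedAddCommGroup F] [NormedSpace 𝕜 F]

section

variable {E : Fin n → Type*} [∀ i, NormedAddCommGroup (E i)] [∀ i, NormedSpace 𝕜 (E i)]

theorem IsFiniteType.zero : IsFiniteType (0 : ContinuousMultilinearMap 𝕜 E F) :=
  ⟨0, Fin.elim0, Fin.elim0, by simp⟩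

theorem IsFiniteType.add {S T : ContinuousMultilinearMap 𝕜 E F} (hS : IsFiniteType S)
    (hT : IsFiniteType T) : IsFiniteType (S + T) := by
  obtain ⟨r, φ, f, h⟩ := hS
  obtain ⟨r', φ', f', h'⟩ := hT
  refine ⟨r + r', Fin.append φ φ', Fin.append f f', fun x => ?_⟩
  simp [Fin.sum_univ_add, h, h']

theorem Approximable.add {S T : ContinuousMultilinearMap 𝕜 E F} (hS : Approximable S)
    (hT : Approximable T) : Approximable (S + T) :=
  map_mem_closure₂ continuous_add hS hT fun _ h _ h' => h.add h'

theorem Approximable.sum {ι : Type*} (s : Finset ι) {S : ι → ContinuousMultilinearMap 𝕜 E F}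
    (hS : ∀ i ∈ s, Approximable (S i)) : Approximable (∑ i ∈ s, S i) :=
  Finset.sum_induction _ _ (fun _ _ => Approximable.add) (subset_closure IsFiniteType.zero) hS

theorem Approximable.of_forall_exists {T : ContinuousMultilinearMap 𝕜 E F}
    (h : ∀ ε > 0, ∃ S : ContinuousMultilinearMap 𝕜 E F, Approximable S ∧ ‖T - S‖ < ε) :
    Approximable T := by
  refine isClosed_closure.closure_subset (Metric.mem_closure_iff.2 fun ε hε => ?_)
  obtain ⟨S, hS, hlt⟩ := h ε hε
  exact ⟨S, hS, by rwa [dist_eq_norm]⟩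

end

variable {E : Fin (n + 1) → Type*} [∀ i, NormedAddCommGroup (E i)] [∀ i, NormedSpace 𝕜 (E i)]

theorem Approximable.uncurryLeft_smulRight (φ : E 0 →L[𝕜] 𝕜)
    {S : ContinuousMultilinearMap 𝕜 (fun i : Fin n => E i.succ) F} (hS : Approximable S) :
    Approximable (φ.smulRight S).uncurryLeft := by
  have hcont : Continuous fun S : ContinuousMultilinearMap 𝕜 (fun i : Fin n => E i.succ) F =>
      (φ.smulRight S).uncurryLeft :=
    (continuousMultilinearCurryLeftEquiv 𝕜 E F).symm.continuous.comp
      (ContinuousLinearMap.smulRightL 𝕜 (E 0) _ φ).continuous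
  refine map_mem_closure (f := fun S => (φ.smulRight S).uncurryLeft) hcont hS ?_
  rintro S ⟨r, ψ, f, h⟩
  refine ⟨r, fun p => Fin.cons φ (ψ p), f, fun x => ?_⟩
  simp only [ContinuousLinearMap.uncurryLeft_apply, ContinuousLinearMap.smulRight_apply,
    smul_apply, h, Finset.smul_sum, Fin.prod_univ_succ, Fin.cons_zero,
    Fin.cons_succ, smul_smul, Fin.tail]

theorem Approximable.of_curryLeft {κ : Type*} (φ : κ → E 0 →L[𝕜] 𝕜)
    {T : ContinuousMultilinearMap 𝕜 E F}
    (h : ∀ ε > 0, ∃ (A : Finset κ)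
      (S : κ → ContinuousMultilinearMap 𝕜 (fun i : Fin n => E i.succ) F),
      (∀ a ∈ A, Approximable (S a)) ∧
        ∀ x, ‖T.curryLeft x - ∑ a ∈ A, φ a x • S a‖ ≤ ε * ‖x‖) :
    Approximable T := by
  refine Approximable.of_forall_exists fun ε hε => ?_
  obtain ⟨A, S, hS, hA⟩ := h (ε / 2) (half_pos hε)
  refine ⟨∑ a ∈ A, ((φ a).smulRight (S a)).uncurryLeft,
    Approximable.sum A fun a ha => (hS a ha).uncurryLeft_smulRight _, ?_⟩
  rw [← ContinuousMultilinearMap.curryLeft_norm]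
  refine lt_of_le_of_lt ?_ (half_lt_self hε)
  refine ContinuousLinearMap.opNorm_le_bound _ (half_pos hε).le fun x => ?_
  refine le_trans (le_of_eq (congrArg norm ?_)) (hA x)
  ext y
  simp

theorem ContainsCopyOfC0.curryLeft (h : ContainsCopyOfC0 𝕜 (ContinuousMultilinearMap 𝕜 E F)) :
    ContainsCopyOfC0 𝕜 (E 0 →L[𝕜] ContinuousMultilinearMap 𝕜 (fun i : Fin n => E i.succ) F) := by
  let e := continuousMultilinearCurryLeftEquiv 𝕜 E F
  exact h.of_isometry (e.toContinuousLinearEquiv :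
    ContinuousMultilinearMap 𝕜 E F →L[𝕜]
      E 0 →L[𝕜] ContinuousMultilinearMap 𝕜 (fun i : Fin n => E i.succ) F) e.norm_map

end Approximable

section Main

variable {𝕜 : Type*} [RCLike 𝕜] {F : Type*} [NormedAddCommGroup F] [NormedSpace 𝕜 F]
  [CompleteSpace F]

theorem not_containsCopyOfC0_multilinear (hF : ¬ ContainsCopyOfC0 𝕜 F) (n : ℕ) (J : Fin n → Type*)
    [∀ i, TopologicalSpace (J i)] [∀ i, DiscreteTopology (J i)] :
    ¬ ContainsCopyOfC0 𝕜 (ContinuousMultilinearMap 𝕜 (fun i => C₀(J i, 𝕜)) F) := by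
  induction n with
  | zero =>
    refine fun h => hF (h.of_isometry
      (ContinuousMultilinearMap.apply 𝕜 (fun i => C₀(J i, 𝕜)) F 0) fun g => ?_)
    refine le_antisymm ?_ ?_
    · simpa using g.le_opNorm 0
    · refine g.opNorm_le_bound (norm_nonneg _) fun x => ?_
      simp [Subsingleton.elim x 0]
  | succ n ih =>
    intro h
    exact not_containsCopyOfC0_clm (ih fun i => J i.succ) (J 0) h.curryLeft

theorem approximable_of_not_containsCopyOfC0 (hF : ¬ ContainsCopyOfC0 𝕜 F) (n : ℕ)
    (J : Fin n → Type*) [∀ i, TopologicalSpace (J i)] [∀ i, DiscreteTopology (J i)]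
    (T : ContinuousMultilinearMap 𝕜 (fun i => C₀(J i, 𝕜)) F) : Approximable T := by
  induction n with
  | zero =>
    refine subset_closure ⟨1, fun _ i => i.elim0, fun _ => T 0, fun x => ?_⟩
    simp [Subsingleton.elim x 0]
  | succ n ih =>
    refine Approximable.of_curryLeft (evalCLM 𝕜) fun ε hε => ?_
    obtain ⟨A, hA⟩ := exists_finset_norm_apply_le
      (not_containsCopyOfC0_multilinear hF n fun i => J i.succ) T.curryLeft hε
    refine ⟨A, fun a => T.curryLeft (unitVec 𝕜 a), fun a _ => ih _ _, fun x => ?_⟩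
    have h1 : T.curryLeft x - ∑ a ∈ A, evalCLM 𝕜 a x • T.curryLeft (unitVec 𝕜 a) =
        T.curryLeft (x - trunc A x) := by
      simp only [map_sub, trunc, map_sum, map_smul, evalCLM_apply]
    rw [h1]
    refine (hA _ fun j hj => by simp [trunc_apply_of_mem x hj]).trans ?_
    gcongr
    exact norm_sub_trunc_le A x

end Main

theorem stmt9 (𝕜 : Type*) [RCLike 𝕜] (n : ℕ) (hn : 1 ≤ n)
    (J : Fin n → Type*) [∀ i, TopologicalSpace (J i)] [∀ i, DiscreteTopology (J i)]
    (F : Type*) [NormedAddCommGroup F] [NormedSpace 𝕜 F] [CompleteSpace F]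
    (hF : ¬ ContainsCopyOfC0 𝕜 F)
    (T : ContinuousMultilinearMap 𝕜 (fun i => ZeroAtInftyContinuousMap (J i) 𝕜) F) :
    Approximable T := by
  exact approximable_of_not_containsCopyOfC0 hF n J T

end GV
end
end

section
/- Let E₁,…,Eₙ be Banach spaces, let z be an element of the completed projective tensor product E₁ ⊗̂_π ⋯ ⊗̂_π Eₙ, and let (w_r)_{r∈ℕ} be a sequence of elements of the algebraic tensor product E₁ ⊗ ⋯ ⊗ Eₙ converging to z in projective norm. Then there exist separable closed subspaces W_j ⊆ E_j (1 ≤ j ≤ n) such that: (1) every w_r belongs to W₁ ⊗ ⋯ ⊗ Wₙ and π(w_r ; W₁ ⊗ ⋯ ⊗ Wₙ) = π(w_r ; E₁ ⊗ ⋯ ⊗ Eₙ); (2) π(w_r − w_l ; W₁ ⊗ ⋯ ⊗ Wₙ) = π(w_r − w_l ; E₁ ⊗ ⋯ ⊗ Eₙ) for all r, l ∈ ℕ; and (3) there exists w ∈ W₁ ⊗̂_π ⋯ ⊗̂_π Wₙ with ι(w) = z, where ι : W₁ ⊗̂_π ⋯ ⊗̂_π Wₙ → E₁ ⊗̂_π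 ⋯ ⊗̂_π Eₙ is the canonical map induced by the inclusions. -/
open scoped TensorProduct
open Filter Topology UniformSpace PiTensorProduct

noncomputable section

namespace GV

variable (𝕜 : Type*) [RCLike 𝕜] {n : ℕ} (E : Fin n → Type*)
  [∀ i, NormedAddCommGroup (E i)] [∀ i, NormedSpace 𝕜 (E i)]

/-- Type synonym for the `n`-fold algebraic tensor product `E₁ ⊗ ⋯ ⊗ Eₙ` equipped with the
projective tensor norm `π`. -/
def ProjTP : Type _ := ⨂[𝕜] i, E i

instance : AddCommGroup (ProjTP 𝕜 E) := inferInstanceAs (AddCommGroup (⨂[𝕜] i, E i))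
instance : Module 𝕜 (ProjTP 𝕜 E) := inferInstanceAs (Module 𝕜 (⨂[𝕜] i, E i))

noncomputable instance : SeminormedAddCommGroup (ProjTP 𝕜 E) :=
  AddGroupSeminorm.toSeminormedAddCommGroup
    (projectiveSeminorm (𝕜 := 𝕜) (E := E)).toAddGroupSeminorm

noncomputable instance : NormedSpace 𝕜 (ProjTP 𝕜 E) where
  norm_smul_le a x :=
    le_of_eq (map_smul_eq_mul (projectiveSeminorm (𝕜 := 𝕜) (E := E)) a x)

/-- The canonical (identity) map from the algebraic tensor product to its projectively
seminormed version. -/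
def ProjTP.of : (⨂[𝕜] i, E i) → ProjTP 𝕜 E := id

/-- The canonical (identity) map from the projectively seminormed tensor product back to the
algebraic tensor product. -/
def ProjTP.down : ProjTP 𝕜 E → ⨂[𝕜] i, E i := id

/-- The canonical map `W₁ ⊗̂_π ⋯ ⊗̂_π Wₙ → E₁ ⊗̂_π ⋯ ⊗̂_π Eₙ` between completed projective
tensor products induced by the inclusions `Wᵢ ↪ Eᵢ` of subspaces. -/
def iotaC (W : ∀ i, Submodule 𝕜 (E i)) :
    Completion (ProjTP 𝕜 (fun i => ↥(W i))) → Completion (ProjTP 𝕜 E) :=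
  Completion.map (fun w =>
    ProjTP.of 𝕜 E (PiTensorProduct.map (fun i => (W i).subtype)
      (ProjTP.down 𝕜 (fun i => ↥(W i)) w)))

/-- The inclusions of subspaces induce an injective map on algebraic tensor products. -/
theorem map_subtype_injective {𝕜 : Type*} [Field 𝕜] {ι : Type*} {E : ι → Type*}
    [∀ i, AddCommGroup (E i)] [∀ i, Module 𝕜 (E i)] (W : ∀ i, Submodule 𝕜 (E i)) :
    Function.Injective (PiTensorProduct.map (fun i => (W i).subtype)) := by
  choose g hg using fun i =>
    LinearMap.exists_leftInverse_of_injective (W i).subtype (W i).ker_subtype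
  refine Function.LeftInverse.injective (g := PiTensorProduct.map g) fun x => ?_
  rw [← LinearMap.comp_apply, ← PiTensorProduct.map_comp]
  simp [hg]

section

variable {𝕜 : Type*} [NontriviallyNormedField 𝕜] {ι : Type*} [Fintype ι] {E : ι → Type*}
  [∀ i, SeminormedAddCommGroup (E i)] [∀ i, NormedSpace 𝕜 (E i)]

theorem norm_map_subtype_le (W : ∀ i, Submodule 𝕜 (E i)) (x : ⨂[𝕜] i, ↥(W i)) :
    ‖PiTensorProduct.map (fun i => (W i).subtype) x‖ ≤ ‖x‖ := by
  have h : ‖mapLIncl W‖ ≤ 1 := (opNorm_mapL _).trans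
    (Finset.prod_le_one (fun _ _ => norm_nonneg _) fun i _ => (W i).norm_subtypeL_le)
  simpa using (mapLIncl W).le_of_opNorm_le h x

/-- A representation of a tensor by vectors of the subspaces `W i` bounds the projective norm of
a preimage relative to these subspaces. -/
theorem exists_map_subtype_eq_norm_le (W : ∀ i, Submodule 𝕜 (E i)) {x : ⨂[𝕜] i, E i}
    {p : FreeAddMonoid (𝕜 × Π i, E i)} (hp : p ∈ lifts x)
    (hW : ∀ q ∈ p.toList, ∀ i, q.2 i ∈ W i) :
    ∃ x' : ⨂[𝕜] i, ↥(W i), PiTensorProduct.map (fun i => (W i).subtype) x' = x ∧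
      ‖x'‖ ≤ projectiveSeminormAux p := by
  obtain ⟨l, hl⟩ : p.toList ∈ Set.range
      (List.map fun q : 𝕜 × Π i, ↥(W i) => (q.1, fun i => (q.2 i : E i))) := by
    rw [Set.range_list_map]
    exact fun q hq => ⟨(q.1, fun i => ⟨q.2 i, hW q hq i⟩), rfl⟩
  refine ⟨(l.map fun q => q.1 • ⨂ₜ[𝕜] i, q.2 i).sum, ?_, ?_⟩
  · rw [mem_lifts_iff, ← hl] at hp
    rw [← hp, map_list_sum]
    simp [Function.comp_def]
  · rw [norm_def]
    refine ciInf_le_of_le (bddBelow_projectiveSemiNormAux _)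
      ⟨FreeAddMonoid.ofList l, (mem_lifts_iff _ _).2 rfl⟩ (le_of_eq ?_)
    simp [projectiveSeminormAux, ← hl, Function.comp_def]

/-- The projective norm of a tensor is already attained relative to all subspaces containing
suitable countable sets. -/
theorem exists_countable_norm_eq (x : ⨂[𝕜] i, E i) :
    ∃ S : ∀ i, Set (E i), (∀ i, (S i).Countable) ∧
      ∀ W : ∀ i, Submodule 𝕜 (E i), (∀ i, S i ⊆ W i) →
        ∃ x' : ⨂[𝕜] i, ↥(W i), PiTensorProduct.map (fun i => (W i).subtype) x' = x ∧
          ‖x'‖ = ‖x‖ := by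
  have key (k : ℕ) : ∃ p : lifts x, projectiveSeminormAux p.1 < ‖x‖ + 1 / ((k : ℝ) + 1) :=
    exists_lt_of_ciInf_lt (lt_add_of_pos_right _ Nat.one_div_pos_of_nat)
  choose p hp using key
  refine ⟨fun i => ⋃ k, (fun q : 𝕜 × Π i, E i => q.2 i) '' {q | q ∈ (p k).1.toList},
    fun i => Set.countable_iUnion fun k => ((List.finite_toSet _).image _).countable,
    fun W hW => ?_⟩
  have hmem (k : ℕ) : ∀ q ∈ (p k).1.toList, ∀ i, q.2 i ∈ W i := fun q hq i =>
    hW i (Set.mem_iUnion.2 ⟨k, q, hq, rfl⟩)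
  choose y hy hyn using fun k => exists_map_subtype_eq_norm_le W (p k).2 (hmem k)
  have heq (k : ℕ) : y k = y 0 := map_subtype_injective W ((hy k).trans (hy 0).symm)
  refine ⟨y 0, hy 0, le_antisymm ?_ ?_⟩
  · refine le_of_tendsto_of_tendsto' tendsto_const_nhds
      (by simpa only [add_zero] using
        (tendsto_one_div_add_atTop_nhds_zero_nat (𝕜 := ℝ)).const_add ‖x‖)
      fun k => ?_
    rw [← heq k]
    exact (hyn k).trans (hp k).le
  · rw [← hy 0]
    exact norm_map_subtype_le W (y 0)

/-- Countably many tensors admit common closed separable subspaces relative to which each of them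
has its original projective norm. -/
theorem exists_separable_norm_eq [TopologicalSpace.SeparableSpace 𝕜] {α : Type*} [Countable α]
    (x : α → ⨂[𝕜] i, E i) :
    ∃ W : ∀ i, Submodule 𝕜 (E i),
      (∀ i, IsClosed (W i : Set (E i)) ∧ TopologicalSpace.IsSeparable (W i : Set (E i))) ∧
      ∀ a, ∃ x' : ⨂[𝕜] i, ↥(W i), PiTensorProduct.map (fun i => (W i).subtype) x' = x a ∧
        ‖x'‖ = ‖x a‖ := by
  choose S hS hx using fun a => exists_countable_norm_eq (x a)
  refine ⟨fun i => (Submodule.span 𝕜 (⋃ a, S a i)).topologicalClosure, fun i =>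
    ⟨Submodule.isClosed_topologicalClosure _, ?_⟩, fun a => hx a _ fun i => ?_⟩
  · rw [Submodule.topologicalClosure_coe]
    exact ((Set.countable_iUnion fun a => hS a i).isSeparable.span).closure
  · exact (Set.subset_iUnion (fun a => S a i) a).trans
      (Submodule.subset_span.trans (Submodule.le_topologicalClosure _))

end

/-- The map `iotaC` extends the map of algebraic tensor products induced by the inclusions. -/
theorem iotaC_coe (W : ∀ i, Submodule 𝕜 (E i)) (x : ⨂[𝕜] i, ↥(W i)) :
    iotaC 𝕜 E W (ProjTP.of 𝕜 (fun i => ↥(W i)) x : ProjTP 𝕜 (fun i => ↥(W i))) =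
      (ProjTP.of 𝕜 E (PiTensorProduct.map (fun i => (W i).subtype) x) : ProjTP 𝕜 E) :=
  Completion.map_coe (mapLIncl W).uniformContinuous _

theorem stmt10 (hn : 1 ≤ n) [∀ i, CompleteSpace (E i)]
    (z : Completion (ProjTP 𝕜 E)) (w : ℕ → ⨂[𝕜] i, E i)
    (hw : Tendsto (fun r => ((ProjTP.of 𝕜 E (w r) : ProjTP 𝕜 E) : Completion (ProjTP 𝕜 E)))
      atTop (𝓝 z)) :
    ∃ W : ∀ i, Submodule 𝕜 (E i),
      (∀ i, IsClosed (W i : Set (E i)) ∧ TopologicalSpace.IsSeparable (W i : Set (E i))) ∧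
      ∃ w' : ℕ → ⨂[𝕜] i, ↥(W i),
        (∀ r, PiTensorProduct.map (fun i => (W i).subtype) (w' r) = w r) ∧
        (∀ r, projectiveSeminorm (w' r) = projectiveSeminorm (w r)) ∧
        (∀ r l, projectiveSeminorm (w' r - w' l) = projectiveSeminorm (w r - w l)) ∧
        ∃ wc : Completion (ProjTP 𝕜 (fun i => ↥(W i))), iotaC 𝕜 E W wc = z := by
  obtain ⟨W, hW, h⟩ := exists_separable_norm_eq
    (Sum.elim w fun q : ℕ × ℕ => w q.1 - w q.2)
  choose w' hw' hnorm using fun r => h (Sum.inl r)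
  have hdiff (r l : ℕ) : projectiveSeminorm (w' r - w' l) = projectiveSeminorm (w r - w l) := by
    obtain ⟨y, hy, hyn⟩ := h (Sum.inr (r, l))
    have : y = w' r - w' l := map_subtype_injective W (by rw [hy, map_sub, hw', hw']; rfl)
    exact this ▸ hyn
  refine ⟨W, hW, w', hw', hnorm, hdiff, ?_⟩
  have hcauchy : CauchySeq fun r =>
      ((ProjTP.of 𝕜 (fun i => ↥(W i)) (w' r) : ProjTP 𝕜 (fun i => ↥(W i))) :
        Completion (ProjTP 𝕜 (fun i => ↥(W i)))) := by
    refine Metric.cauchySeq_iff'.2 fun ε hε => ?_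
    obtain ⟨N, hN⟩ := Metric.cauchySeq_iff'.1 hw.cauchySeq ε hε
    refine ⟨N, fun r hr => ?_⟩
    have := hN r hr
    rw [Completion.dist_eq, dist_eq_norm] at this ⊢
    exact (hdiff r N).trans_lt this
  obtain ⟨wc, hwc⟩ := cauchySeq_tendsto_of_complete hcauchy
  refine ⟨wc, tendsto_nhds_unique ?_ hw⟩
  have hcont : Continuous (iotaC 𝕜 E W) := Completion.continuous_map
  refine ((hcont.tendsto wc).comp hwc).congr fun r => ?_
  exact (iotaC_coe 𝕜 E W (w' r)).trans (by rw [hw', Sum.elim_inl])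

end GV
end
end

section
/- Let E₁,…,Eₙ be Banach spaces and let S be a separable closed linear subspace of the completed projective tensor product E₁ ⊗̂_π ⋯ ⊗̂_π Eₙ. Then there exist separable closed subspaces W_j ⊆ E_j (1 ≤ j ≤ n) such that S embeds isometrically into W₁ ⊗̂_π ⋯ ⊗̂_π Wₙ via the canonical map: for every v ∈ S there exists w ∈ W₁ ⊗̂_π ⋯ ⊗̂_π Wₙ with ι(w) = v and ‖w‖_{W₁ ⊗̂_π ⋯ ⊗̂_π Wₙ} = ‖v‖_{E₁ ⊗̂_π ⋯ ⊗̂_π Eₙ}, where ι : W₁ ⊗̂_π ⋯ ⊗̂_π Wₙ → E₁ ⊗̂_π ⋯ ⊗̂_π Eₙ is the canonical map induced by the inclusions. -/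
open scoped TensorProduct
open Filter Topology UniformSpace PiTensorProduct

noncomputable section

namespace GV

variable (𝕜 : Type*) [RCLike 𝕜] {n : ℕ} (E : Fin n → Type*)
  [∀ i, NormedAddCommGroup (E i)] [∀ i, NormedSpace 𝕜 (E i)]

section Auxiliary

variable {𝕜 E} {U V W : ∀ i, Submodule 𝕜 (E i)}

/-- The map between projective tensor products induced by inclusions of subspaces. -/
def tensorInclusion (h : ∀ i, V i ≤ W i) : (⨂[𝕜] i, V i) →L[𝕜] ⨂[𝕜] i, W i :=
  mapL fun i => (V i).subtypeL.codRestrict (W i) fun x => h i x.2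

lemma norm_mapL_le_of_le_one {F G : Fin n → Type*}
    [∀ i, NormedAddCommGroup (F i)] [∀ i, NormedSpace 𝕜 (F i)]
    [∀ i, NormedAddCommGroup (G i)] [∀ i, NormedSpace 𝕜 (G i)]
    (f : ∀ i, F i →L[𝕜] G i) (hf : ∀ i, ‖f i‖ ≤ 1) (x : ⨂[𝕜] i, F i) :
    ‖mapL f x‖ ≤ ‖x‖ :=
  (mapL f).le_of_opNorm_le ((opNorm_mapL f).trans
    (Finset.prod_le_one (fun _ _ => norm_nonneg _) fun i _ => hf i)) x |>.trans_eq (one_mul _)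

lemma norm_tensorInclusion_le (h : ∀ i, V i ≤ W i) (x : ⨂[𝕜] i, V i) :
    ‖tensorInclusion h x‖ ≤ ‖x‖ :=
  norm_mapL_le_of_le_one _ (fun i => ContinuousLinearMap.opNorm_le_bound _ zero_le_one
    fun x => by simp) x

lemma norm_mapLIncl_le (x : ⨂[𝕜] i, V i) : ‖mapLIncl V x‖ ≤ ‖x‖ :=
  norm_mapL_le_of_le_one _ (fun i => (V i).norm_subtypeL_le) x

lemma mapLIncl_tensorInclusion (h : ∀ i, V i ≤ W i) (x : ⨂[𝕜] i, V i) :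
    mapLIncl W (tensorInclusion h x) = mapLIncl V x := by
  simp only [mapLIncl, tensorInclusion]
  rw [← ContinuousLinearMap.comp_apply, ← mapL_comp]
  rfl

lemma mapLIncl_injective (V : ∀ i, Submodule 𝕜 (E i)) :
    Function.Injective (mapLIncl V) := by
  choose g hg using fun i => (V i).subtype.exists_leftInverse_of_injective (V i).ker_subtype
  refine Function.LeftInverse.injective (g := PiTensorProduct.map g) fun x => ?_
  change PiTensorProduct.map g (PiTensorProduct.map (fun i => (V i).subtype) x) = x
  rw [← LinearMap.comp_apply, ← PiTensorProduct.map_comp]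
  simp [hg, PiTensorProduct.map_id]

lemma tensorInclusion_tensorInclusion (h : ∀ i, U i ≤ V i) (h' : ∀ i, V i ≤ W i)
    (x : ⨂[𝕜] i, U i) :
    tensorInclusion h' (tensorInclusion h x) =
      tensorInclusion (fun i => (h i).trans (h' i)) x :=
  mapLIncl_injective W (by simp only [mapLIncl_tensorInclusion])

lemma exists_mapLIncl_eq_sum (l : List (𝕜 × Π i, E i)) (hl : ∀ q ∈ l, ∀ i, q.2 i ∈ V i) :
    ∃ x : ⨂[𝕜] i, V i, mapLIncl V x = (l.map fun q => q.1 • ⨂ₜ[𝕜] i, q.2 i).sum ∧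
      ‖x‖ ≤ (l.map fun q => ‖q.1‖ * ∏ i, ‖q.2 i‖).sum := by
  induction l with
  | nil => exact ⟨0, by simp, projectiveSeminorm_zero.le⟩
  | cons q l ih =>
    obtain ⟨x, hx, hxn⟩ := ih fun q' h' => hl q' (List.mem_cons_of_mem _ h')
    have hq : ∀ i, q.2 i ∈ V i := hl q List.mem_cons_self
    refine ⟨(q.1 • ⨂ₜ[𝕜] i, (⟨q.2 i, hq i⟩ : V i)) + x, ?_, ?_⟩
    · rw [map_add, hx, map_smul]
      simp
    · rw [List.map_cons, List.sum_cons]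
      refine (projectiveSeminorm_add_le _ _).trans (add_le_add ?_ hxn)
      refine (projectiveSeminorm_smul_le _ _).trans ?_
      gcongr
      exact projectiveSeminorm_tprod_le _

/-- Countably many tensors are, up to arbitrarily small errors in the norm, represented by vectors
in a countable family of sets. -/
lemma exists_countable_representing {D : Set (⨂[𝕜] i, E i)} (hD : D.Countable) :
    ∃ A : ∀ i, Set (E i), (∀ i, (A i).Countable) ∧
      ∀ V : ∀ i, Submodule 𝕜 (E i), (∀ i, A i ⊆ V i) →
        ∀ d ∈ D, ∀ ε > 0, ∃ x : ⨂[𝕜] i, V i, mapLIncl V x = d ∧ ‖x‖ ≤ ‖d‖ + ε := by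
  have key : ∀ (d : ⨂[𝕜] i, E i) (m : ℕ), ∃ p : lifts d,
      projectiveSeminormAux p.1 < ‖d‖ + 1 / (m + 1 : ℝ) := fun d m =>
    exists_lt_of_ciInf_lt (lt_add_of_pos_right _ Nat.one_div_pos_of_nat)
  choose p hp using key
  refine ⟨fun i => ⋃ d ∈ D, ⋃ m : ℕ, (fun q : 𝕜 × Π i, E i => q.2 i) ''
    {q | q ∈ (p d m).1.toList}, fun i => ?_, fun V hV d hd ε hε => ?_⟩
  · exact hD.biUnion fun d _ => Set.countable_iUnion fun m =>
      ((p d m).1.toList.finite_toSet.countable).image _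
  · obtain ⟨m, hm⟩ := exists_nat_one_div_lt hε
    obtain ⟨x, hx, hxn⟩ := exists_mapLIncl_eq_sum (V := V) (p d m).1.toList fun q hq i =>
      hV i (Set.mem_biUnion hd (Set.mem_iUnion.2 ⟨m, q, hq, rfl⟩))
    refine ⟨x, hx.trans ((mem_lifts_iff _ _).1 (p d m).2), hxn.trans ?_⟩
    exact ((hp d m).trans (by gcongr)).le

lemma continuous_projectiveNorm : Continuous fun x : ⨂[𝕜] i, E i => ‖x‖ := continuous_norm

lemma isometry_mapLIncl (h : ∀ x, ‖mapLIncl V x‖ = ‖x‖) : Isometry (mapLIncl V) :=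
  AddMonoidHomClass.isometry_of_norm (mapLIncl V) h

/-- A subspace containing the elementary tensors of a family of dense sets is dense. -/
lemma dense_of_tprod_mem {A : ∀ i, Set (E i)} (hA : ∀ i, Dense (A i))
    {M : Submodule 𝕜 (⨂[𝕜] i, E i)}
    (hM : ∀ v : ∀ i, E i, (∀ i, v i ∈ A i) → (⨂ₜ[𝕜] i, v i) ∈ M) :
    Dense (M : Set (⨂[𝕜] i, E i)) := by
  rw [Submodule.dense_iff_topologicalClosure_eq_top, eq_top_iff, ← span_tprod_eq_top,
    Submodule.span_le]
  rintro _ ⟨w, rfl⟩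
  refine closure_mono ?_ (image_closure_subset_closure_image (tprodL 𝕜 (E := E)).cont
    ⟨w, dense_pi Set.univ (fun i _ => hA i) w, rfl⟩)
  rintro _ ⟨v, hv, rfl⟩
  exact hM v fun i => hv i trivial

lemma isSeparable_univ_piTensorProduct
    (hV : ∀ i, TopologicalSpace.IsSeparable (V i : Set (E i))) :
    TopologicalSpace.IsSeparable (Set.univ : Set (⨂[𝕜] i, V i)) := by
  have : ∀ i, TopologicalSpace.SeparableSpace (V i) := fun i => (hV i).separableSpace
  have h := (TopologicalSpace.isSeparable_range
    (tprodL 𝕜 (E := fun i => V i)).cont).span (R := 𝕜)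
  refine h.mono fun x _ => ?_
  have hx : x ∈ Submodule.span 𝕜 (Set.range (tprod 𝕜 (s := fun i => V i))) := by
    rw [span_tprod_eq_top]; trivial
  exact hx

/-- A separable family of subspaces can be enlarged to a separable family computing the projective
norm of the ambient tensor product on the original one. -/
lemma exists_enlargement (hV : ∀ i, TopologicalSpace.IsSeparable (V i : Set (E i))) :
    ∃ (W : ∀ i, Submodule 𝕜 (E i)) (h : ∀ i, V i ≤ W i),
      (∀ i, TopologicalSpace.IsSeparable (W i : Set (E i))) ∧
      ∀ x : ⨂[𝕜] i, V i, ‖tensorInclusion h x‖ ≤ ‖mapLIncl V x‖ := by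
  obtain ⟨D, hD, hDd⟩ := isSeparable_univ_piTensorProduct hV
  obtain ⟨A, hA, hAV⟩ := exists_countable_representing (hD.image (mapLIncl V))
  have h : ∀ i, V i ≤ Submodule.span 𝕜 (V i ∪ A i : Set (E i)) := fun i x hx =>
    Submodule.subset_span (Or.inl hx)
  refine ⟨fun i => Submodule.span 𝕜 (V i ∪ A i : Set (E i)), h,
    fun i => ((hV i).union (hA i).isSeparable).span, fun x => ?_⟩
  refine closure_minimal (t := {x | ‖tensorInclusion h x‖ ≤ ‖mapLIncl V x‖}) (fun d hd => ?_)
    (isClosed_le (continuous_projectiveNorm.comp (tensorInclusion h).continuous)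
      (continuous_projectiveNorm.comp (mapLIncl V).continuous))
    (hDd (Set.mem_univ x))
  change ‖tensorInclusion h d‖ ≤ ‖mapLIncl V d‖
  refine le_of_forall_pos_le_add fun ε hε => ?_
  obtain ⟨y, hy, hyn⟩ := hAV _ (fun i a ha => Submodule.subset_span (Or.inr ha)) _
    (Set.mem_image_of_mem _ hd) ε hε
  rwa [mapLIncl_injective _ (hy.trans (mapLIncl_tensorInclusion h d).symm)] at hyn

lemma denseRange_tensorInclusion (h : ∀ i, V i ≤ W i)
    (hd : ∀ i, (W i : Set (E i)) ⊆ closure (V i)) : DenseRange (tensorInclusion h) := by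
  refine dense_of_tprod_mem (E := fun i => W i) (A := fun i => {x : W i | (x : E i) ∈ V i})
    (M := LinearMap.range (tensorInclusion h).toLinearMap) (fun i w => ?_) fun v hv => ?_
  · rw [closure_subtype]
    refine closure_mono ?_ (hd i w.2)
    exact fun x hx => ⟨⟨x, h i hx⟩, hx, rfl⟩
  · refine ⟨⨂ₜ[𝕜] i, (⟨v i, hv i⟩ : V i), ?_⟩
    change mapL _ _ = _
    simp
    rfl

lemma exists_tensorInclusion_eq_of_monotone {V : ℕ → ∀ i, Submodule 𝕜 (E i)} (hV : Monotone V)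
    (h : ∀ k i, V k i ≤ W i) (hW : ∀ i, ∀ x ∈ W i, ∃ k, x ∈ V k i) (x : ⨂[𝕜] i, W i) :
    ∃ k, ∃ y : ⨂[𝕜] i, V k i, tensorInclusion (h k) y = x := by
  induction x using PiTensorProduct.induction_on with
  | smul_tprod r w =>
    choose k hk using fun i => hW i (w i) (w i).2
    have hm : ∀ i, (w i : E i) ∈ V (Finset.univ.sup k) i := fun i =>
      hV (Finset.le_sup (Finset.mem_univ i)) i (hk i)
    refine ⟨_, r • ⨂ₜ[𝕜] i, (⟨w i, hm i⟩ : V (Finset.univ.sup k) i), ?_⟩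
    rw [map_smul]
    change r • mapL _ _ = _
    simp
    rfl
  | add x y hx hy =>
    obtain ⟨k, x, rfl⟩ := hx
    obtain ⟨l, y, rfl⟩ := hy
    refine ⟨max k l, tensorInclusion (hV (le_max_left k l)) x +
      tensorInclusion (hV (le_max_right k l)) y, ?_⟩
    rw [map_add, tensorInclusion_tensorInclusion, tensorInclusion_tensorInclusion]

/-- Every separable family of subspaces is contained in a family of closed separable subspaces
whose projective tensor product embeds isometrically. -/
lemma exists_isClosed_isSeparable_isometry
    (hV : ∀ i, TopologicalSpace.IsSeparable (V i : Set (E i))) :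
    ∃ W : ∀ i, Submodule 𝕜 (E i), (∀ i, V i ≤ W i) ∧
      (∀ i, IsClosed (W i : Set (E i)) ∧ TopologicalSpace.IsSeparable (W i : Set (E i))) ∧
      Isometry (mapLIncl W) := by
  choose! F hF hFsep hFnorm using
    fun (V : ∀ i, Submodule 𝕜 (E i)) hV => exists_enlargement (V := V) hV
  let X : ℕ → ∀ i, Submodule 𝕜 (E i) := fun k => F^[k] V
  have hX : ∀ k, X (k + 1) = F (X k) := fun k => Function.iterate_succ_apply' F k V
  have hXsep : ∀ k i, TopologicalSpace.IsSeparable (X k i : Set (E i)) := by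
    intro k
    induction k with
    | zero => exact hV
    | succ k ih => rw [hX]; exact hFsep _ ih
  have hmono : Monotone X := monotone_nat_of_le_succ fun k => by
    rw [hX]; exact hF _ (hXsep k)
  let Y : ∀ i, Submodule 𝕜 (E i) := fun i => ⨆ k, X k i
  have hXi : ∀ i, Monotone fun k => X k i := fun i k l hkl => hmono hkl i
  have hY : ∀ i, ∀ x ∈ Y i, ∃ k, x ∈ X k i := fun i x hx =>
    (Submodule.mem_iSup_of_directed _ (hXi i).directed_le).1 hx
  have hXY : ∀ k i, X k i ≤ Y i := fun k i => le_iSup (fun k => X k i) k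
  have hYsep : ∀ i, TopologicalSpace.IsSeparable (Y i : Set (E i)) := fun i =>
    (TopologicalSpace.IsSeparable.iUnion fun k => hXsep k i).mono fun x hx =>
      Set.mem_iUnion.2 (hY i x hx)
  have hYnorm : ∀ y : ⨂[𝕜] i, Y i, ‖y‖ ≤ ‖mapLIncl Y y‖ := by
    intro y
    obtain ⟨k, x, rfl⟩ := exists_tensorInclusion_eq_of_monotone hmono hXY hY y
    have hFY : ∀ i, F (X k) i ≤ Y i := by rw [← hX]; exact hXY (k + 1)
    rw [mapLIncl_tensorInclusion, ← tensorInclusion_tensorInclusion (hF _ (hXsep k)) hFY]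
    exact (norm_tensorInclusion_le _ _).trans (hFnorm _ (hXsep k) x)
  have hYW : ∀ i, Y i ≤ (Y i).topologicalClosure := fun i => (Y i).le_topologicalClosure
  refine ⟨fun i => (Y i).topologicalClosure, fun i => (hXY 0 i).trans (hYW i),
    fun i => ⟨(Y i).isClosed_topologicalClosure, (hYsep i).closure⟩, ?_⟩
  refine isometry_mapLIncl fun x => (norm_mapLIncl_le x).antisymm ?_
  refine (denseRange_tensorInclusion hYW fun i => subset_rfl).induction_on
    (p := fun x => ‖x‖ ≤ ‖mapLIncl (fun i => (Y i).topologicalClosure) x‖) x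
    (isClosed_le continuous_projectiveNorm
      (continuous_projectiveNorm.comp (ContinuousLinearMap.continuous _))) fun y => ?_
  rw [mapLIncl_tensorInclusion]
  exact (norm_tensorInclusion_le _ _).trans (hYnorm y)

end Auxiliary

theorem stmt11 (hn : 1 ≤ n) [∀ i, CompleteSpace (E i)]
    (S : Submodule 𝕜 (Completion (ProjTP 𝕜 E)))
    (hSclosed : IsClosed (S : Set (Completion (ProjTP 𝕜 E))))
    (hSsep : TopologicalSpace.IsSeparable (S : Set (Completion (ProjTP 𝕜 E)))) :
    ∃ W : ∀ i, Submodule 𝕜 (E i),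
      (∀ i, IsClosed (W i : Set (E i)) ∧ TopologicalSpace.IsSeparable (W i : Set (E i))) ∧
      ∀ v ∈ S, ∃ wc : Completion (ProjTP 𝕜 (fun i => ↥(W i))),
        iotaC 𝕜 E W wc = v ∧ ‖wc‖ = ‖v‖ := by
  obtain ⟨C, hC, hSC⟩ := hSsep
  have happrox : ∀ (c : Completion (ProjTP 𝕜 E)) (m : ℕ), ∃ y : ProjTP 𝕜 E,
      dist c (y : Completion (ProjTP 𝕜 E)) < 1 / (m + 1 : ℝ) := fun c m =>
    Completion.denseRange_coe.exists_dist_lt c Nat.one_div_pos_of_nat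
  choose y hy using happrox
  let D : Set (⨂[𝕜] i, E i) := ⋃ c ∈ C, Set.range fun m => ProjTP.down 𝕜 E (y c m)
  have hD : D.Countable := hC.biUnion fun c _ => Set.countable_range _
  obtain ⟨A, hA, hAV⟩ := exists_countable_representing hD
  obtain ⟨W, hVW, hW, hiso⟩ := exists_isClosed_isSeparable_isometry
    (V := fun i => Submodule.span 𝕜 (A i)) fun i => (hA i).isSeparable.span
  let f : ProjTP 𝕜 (fun i => ↥(W i)) → ProjTP 𝕜 E := fun w =>
    ProjTP.of 𝕜 E (PiTensorProduct.map (fun i => (W i).subtype)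
      (ProjTP.down 𝕜 (fun i => ↥(W i)) w))
  have hf : Isometry f := hiso
  have hfC : Isometry (iotaC 𝕜 E W) := hf.completion_map
  have hcoe : ∀ w : ProjTP 𝕜 (fun i => ↥(W i)), iotaC 𝕜 E W w = f w := Completion.map_coe hf.uniformContinuous
  have hclosed : IsClosed (Set.range (iotaC 𝕜 E W)) := hfC.isClosedEmbedding.isClosed_range
  have hCr : C ⊆ Set.range (iotaC 𝕜 E W) := by
    intro c hc
    rw [← hclosed.closure_eq, Metric.mem_closure_iff]
    intro ε hε
    obtain ⟨m, hm⟩ := exists_nat_one_div_lt hε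
    obtain ⟨(x : ProjTP 𝕜 (fun i => ↥(W i))), hx, -⟩ := hAV W (fun i => Submodule.subset_span.trans (hVW i)) _
      (Set.mem_biUnion hc ⟨m, rfl⟩) 1 one_pos
    have hfx : f x = y c m := hx
    refine ⟨_, ⟨(x : Completion _), rfl⟩, ?_⟩
    rw [hcoe]
    exact (congrArg (fun z : ProjTP 𝕜 E => dist c (z : Completion (ProjTP 𝕜 E)))
      hfx).trans_lt ((hy c m).trans hm)
  refine ⟨W, hW, fun v hv => ?_⟩
  obtain ⟨w, rfl⟩ := closure_minimal hCr hclosed (hSC hv)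
  refine ⟨w, rfl, ?_⟩
  have hzero : iotaC 𝕜 E W 0 = 0 := by
    rw [← Completion.coe_zero, hcoe, ← Completion.coe_zero]
    exact congrArg _ (map_zero (PiTensorProduct.map fun i => (W i).subtype))
  rw [← dist_zero_right, ← dist_zero_right, ← hfC.dist_eq, hzero]

end GV
end
end

section
/- Let n ≥ 1 and let T : c₀ × ⋯ × c₀ → F be a continuous n-linear map into a Banach space F. Let (k_j)_{j∈ℕ} be a strictly increasing sequence of natural numbers and, for each 1 ≤ i ≤ n, let (v_j^i)_{j∈ℕ} be a sequence in c₀ such that v_j^i is supported on the coordinates {k_j + 1, …, k_{j+1}} and ‖v_j^i‖ ≤ 1. Then the series Σ_{j∈ℕ} T(v_j^1,…,v_j^n) is weakly unconditionally Cauchy: for every continuous linear functional φ ∈ F' one has Σ_{j∈ℕ} |φ(T(v_j^1,…,v_j^n))| ≤ ‖φ ∘ T‖, where ‖φ ∘ T‖ is the operator norm of the scalar n-linear form φ ∘ T. -/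
open Filter Topology

noncomputable section

namespace GV

theorem sum_units_mul_eq_ite {ι 𝕜 : Type*} [Fintype ι] [DecidableEq ι] [RCLike 𝕜] (i j : ι) :
    ∑ ε : ι → ℤˣ, (((ε i : ℤˣ) : ℤ) : 𝕜) * (((ε j : ℤˣ) : ℤ) : 𝕜) =
      if i = j then (Fintype.card (ι → ℤˣ) : 𝕜) else 0 := by
  split_ifs with h
  · subst h
    have h1 : ∀ u : ℤˣ, ((u : ℤ) : 𝕜) * ((u : ℤ) : 𝕜) = 1 := fun u => by
      rw [← Int.cast_mul, ← Units.val_mul, Int.units_mul_self]; simp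
    simp [h1]
  · have key := Equiv.sum_comp (Equiv.mulLeft (Pi.mulSingle i (-1) : ι → ℤˣ))
      (fun ε : ι → ℤˣ => (((ε i : ℤˣ) : ℤ) : 𝕜) * (((ε j : ℤˣ) : ℤ) : 𝕜))
    have h2 : (Pi.mulSingle i (-1) : ι → ℤˣ) j = 1 := Pi.mulSingle_eq_of_ne (Ne.symm h) _
    simp only [Equiv.coe_mulLeft, Pi.mul_apply, Pi.mulSingle_eq_same, h2] at key
    simp only [Units.val_neg, neg_mul, one_mul, Int.cast_neg,
      Finset.sum_neg_distrib] at key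
    exact self_eq_neg.mp key.symm

/-- The trace of a matrix is bounded by any bound for its quadratic form on vectors of signs. -/
theorem norm_sum_diag_le {ι 𝕜 : Type*} [Fintype ι] [RCLike 𝕜] (b : ι → ι → 𝕜) (C : ℝ)
    (hb : ∀ ε : ι → ℤˣ,
      ‖∑ j, ∑ i, (((ε i : ℤˣ) : ℤ) : 𝕜) * (((ε j : ℤˣ) : ℤ) : 𝕜) * b i j‖ ≤ C) :
    ‖∑ j, b j j‖ ≤ C := by
  classical
  have hsum : ∑ ε : ι → ℤˣ, ∑ j, ∑ i, (((ε i : ℤˣ) : ℤ) : 𝕜) * (((ε j : ℤˣ) : ℤ) : 𝕜) * b i j =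
      (Fintype.card (ι → ℤˣ) : 𝕜) * ∑ j, b j j := by
    rw [Finset.sum_comm, Finset.mul_sum]
    refine Finset.sum_congr rfl fun j _ => ?_
    rw [Finset.sum_comm]
    simp_rw [← Finset.sum_mul, sum_units_mul_eq_ite]
    simp
  have hle := norm_sum_le_of_le Finset.univ (fun ε _ => hb ε)
  rw [hsum, norm_mul, RCLike.norm_natCast, Finset.sum_const, nsmul_eq_mul, Finset.card_univ] at hle
  exact le_of_mul_le_mul_left hle (Nat.cast_pos.mpr Fintype.card_pos)

theorem norm_sum_mul_diag_le {𝕜 ι : Type*} [RCLike 𝕜] [Fintype ι] (n : ℕ)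
    {E : Type*} [NormedAddCommGroup E] [NormedSpace 𝕜 E]
    (f : ContinuousMultilinearMap 𝕜 (fun _ : Fin (n + 1) => E) 𝕜) (v : Fin (n + 1) → ι → E)
    (hv : ∀ i (a : ι → 𝕜), (∀ j, ‖a j‖ ≤ 1) → ‖∑ j, a j • v i j‖ ≤ 1)
    (c : ι → 𝕜) (hc : ∀ j, ‖c j‖ ≤ 1) :
    ‖∑ j, c j * f (fun i => v i j)‖ ≤ ‖f‖ := by
  induction n generalizing c with
  | zero =>
    have h : ∑ j, c j * f (fun i => v i j) = f (fun _ => ∑ j, c j • v 0 j) := by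
      have h0 : ∀ x : E, f (fun _ => x) = f.toContinuousLinearMap (fun _ => 0) 0 x := fun x => by
        rw [ContinuousMultilinearMap.toContinuousLinearMap_apply]
        congr 1
        ext i
        rw [show i = 0 from Fin.fin_one_eq_zero i, Function.update_self]
      rw [h0, map_sum]
      refine Finset.sum_congr rfl fun j _ => ?_
      rw [map_smul, ← h0, smul_eq_mul]
      congr 2
      ext i
      rw [show i = 0 from Fin.fin_one_eq_zero i]
    rw [h]
    refine (f.le_opNorm _).trans ?_
    simpa using mul_le_mul_of_nonneg_left (hv 0 c hc) (norm_nonneg f)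
  | succ n ih =>
    have hε : ∀ u : ℤˣ, ‖((u : ℤ) : 𝕜)‖ = 1 := fun u => by
      rcases Int.units_eq_one_or u with rfl | rfl <;> simp
    have hdiag : ∀ j, f (fun i => v i j) = f.curryLeft (v 0 j) (fun i => v i.succ j) := fun j => by
      rw [ContinuousMultilinearMap.curryLeft_apply]
      congr 1
      exact (Fin.cons_self_tail (fun i => v i j)).symm
    simp_rw [hdiag]
    refine norm_sum_diag_le (fun i j => c j * f.curryLeft (v 0 i) (fun l => v l.succ j)) _
      fun ε => ?_
    set x : E := ∑ i, (((ε i : ℤˣ) : ℤ) : 𝕜) • v 0 i with hx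
    have hx1 : ‖x‖ ≤ 1 := hv 0 _ fun j => (hε _).le
    have hrw : ∑ j, ∑ i, (((ε i : ℤˣ) : ℤ) : 𝕜) * (((ε j : ℤˣ) : ℤ) : 𝕜) *
          (c j * f.curryLeft (v 0 i) (fun l => v l.succ j)) =
        ∑ j, ((((ε j : ℤˣ) : ℤ) : 𝕜) * c j) * f.curryLeft x (fun l => v l.succ j) := by
      refine Finset.sum_congr rfl fun j _ => ?_
      rw [hx, map_sum, _root_.sum_apply, Finset.mul_sum]
      refine Finset.sum_congr rfl fun i _ => ?_
      rw [map_smul, _root_.smul_apply, smul_eq_mul]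
      ring
    rw [hrw]
    refine (ih (f.curryLeft x) (fun i => v i.succ) (fun i => hv i.succ) _ fun j => ?_).trans ?_
    · rw [norm_mul, hε, one_mul]; exact hc j
    · refine (f.curryLeft.le_opNorm x).trans ?_
      rw [ContinuousMultilinearMap.curryLeft_norm]
      exact mul_le_of_le_one_right (norm_nonneg f) hx1

theorem sum_norm_diag_le {𝕜 ι : Type*} [RCLike 𝕜] [Fintype ι] (n : ℕ)
    {E : Type*} [NormedAddCommGroup E] [NormedSpace 𝕜 E]
    (f : ContinuousMultilinearMap 𝕜 (fun _ : Fin (n + 1) => E) 𝕜) (v : Fin (n + 1) → ι → E)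
    (hv : ∀ i (a : ι → 𝕜), (∀ j, ‖a j‖ ≤ 1) → ‖∑ j, a j • v i j‖ ≤ 1) :
    ∑ j, ‖f (fun i => v i j)‖ ≤ ‖f‖ := by
  have hsign : ∀ z : 𝕜, ∃ c : 𝕜, ‖c‖ ≤ 1 ∧ c * z = (‖z‖ : 𝕜) := fun z => by
    by_cases hz : z = 0
    · exact ⟨0, by simp, by simp [hz]⟩
    · have hz' : (‖z‖ : 𝕜) ≠ 0 := by simpa using hz
      refine ⟨(starRingEnd 𝕜) z / (‖z‖ : 𝕜), ?_, ?_⟩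
      · simp [hz]
      · rw [div_mul_eq_mul_div, RCLike.conj_mul, sq, mul_div_assoc, div_self hz', mul_one]
  choose c hc hcz using hsign
  have h := norm_sum_mul_diag_le n f v hv (fun j => c (f fun i => v i j)) fun j => hc _
  simp_rw [hcz] at h
  rw [← RCLike.ofReal_sum, RCLike.norm_ofReal] at h
  exact (le_abs_self _).trans h

theorem norm_sum_smul_le_one_of_disjoint_support {𝕜 ι : Type*} [RCLike 𝕜] [Fintype ι]
    (w : ι → ZeroAtInftyContinuousMap ℕ 𝕜) (hw : ∀ j, ‖w j‖ ≤ 1)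
    (hdisj : ∀ l i j, w i l ≠ 0 → w j l ≠ 0 → i = j) (a : ι → 𝕜) (ha : ∀ j, ‖a j‖ ≤ 1) :
    ‖∑ j, a j • w j‖ ≤ 1 := by
  rw [← ZeroAtInftyContinuousMap.norm_toBCF_eq_norm, BoundedContinuousFunction.norm_le zero_le_one]
  intro l
  have happ : (∑ j, a j • w j) l = ∑ j, a j * w j l := by
    have := map_sum (⟨⟨fun g : ZeroAtInftyContinuousMap ℕ 𝕜 => g l, rfl⟩, fun _ _ => rfl⟩ :
      ZeroAtInftyContinuousMap ℕ 𝕜 →+ 𝕜) (fun j => a j • w j) Finset.univ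
    exact this
  change ‖(∑ j, a j • w j) l‖ ≤ 1
  rw [happ]
  by_cases h : ∃ j, w j l ≠ 0
  · obtain ⟨j, hj⟩ := h
    rw [Finset.sum_eq_single j (fun i _ hij => ?_) (by simp), norm_mul]
    · have hwl : ‖w j l‖ ≤ ‖w j‖ := by
        rw [← ZeroAtInftyContinuousMap.norm_toBCF_eq_norm]
        exact (w j).toBCF.norm_coe_le_norm l
      exact mul_le_one₀ (ha j) (norm_nonneg _) (hwl.trans (hw j))
    · by_contra hne
      exact hij (hdisj l i j (right_ne_zero_of_mul hne) hj)
  · push Not at h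
    simp [h]

theorem stmt12 (𝕜 : Type*) [RCLike 𝕜] (n : ℕ) (hn : 1 ≤ n)
    (F : Type*) [NormedAddCommGroup F] [NormedSpace 𝕜 F] [CompleteSpace F]
    (T : ContinuousMultilinearMap 𝕜 (fun _ : Fin n => ZeroAtInftyContinuousMap ℕ 𝕜) F)
    (k : ℕ → ℕ) (hk : StrictMono k)
    (v : Fin n → ℕ → ZeroAtInftyContinuousMap ℕ 𝕜)
    (hsupp : ∀ (i : Fin n) (j l : ℕ), l ∉ Set.Ioc (k j) (k (j + 1)) → v i j l = 0)
    (hnorm : ∀ (i : Fin n) (j : ℕ), ‖v i j‖ ≤ 1) :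
    ∀ φ : F →L[𝕜] 𝕜,
      Summable (fun j => ‖φ (T (fun i => v i j))‖) ∧
      ∑' j, ‖φ (T (fun i => v i j))‖ ≤ ‖φ.compContinuousMultilinearMap T‖ := by
  intro φ
  obtain ⟨m, rfl⟩ : ∃ m, n = m + 1 := ⟨n - 1, by omega⟩
  have hdisj : ∀ i l p q, v i p l ≠ 0 → v i q l ≠ 0 → p = q := by
    intro i l p q hp hq
    have hp' : l ∈ Set.Ioc (k p) (k (p + 1)) := not_not.mp (mt (hsupp i p l) hp)
    have hq' : l ∈ Set.Ioc (k q) (k (q + 1)) := not_not.mp (mt (hsupp i q l) hq)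
    have h1 := hk.lt_iff_lt.mp (hp'.1.trans_le hq'.2)
    have h2 := hk.lt_iff_lt.mp (hq'.1.trans_le hp'.2)
    omega
  have hbound : ∀ N, ∑ j ∈ Finset.range N, ‖φ (T (fun i => v i j))‖ ≤
      ‖φ.compContinuousMultilinearMap T‖ := fun N => by
    rw [Finset.sum_range]
    exact sum_norm_diag_le m (φ.compContinuousMultilinearMap T) (fun i (j : Fin N) => v i j)
      fun i => norm_sum_smul_le_one_of_disjoint_support _ (fun j => hnorm i j)
        fun l p q hp hq => Fin.ext (hdisj i l p q hp hq)
  exact ⟨summable_of_sum_range_le (fun _ => norm_nonneg _) hbound,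
    Real.tsum_le_of_sum_range_le (fun _ => norm_nonneg _) hbound⟩

end GV
end
end
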